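/- arXiv:1811.05376 — 2 statements merged into one kernel-verified Lean document; each statement's English description precedes it below -/
import Mathlib

section
/- Let ρ : G → SL(2,ℂ) be a group homomorphism that is not the trivial homomorphism. Then there exist integers l'_1, …, l'_n such that p_j divides l'_j for at most n − 3 of the indices j ∈ {1, …, n}, and matrices S_1, …, S_n ∈ SL(2,ℂ), such that ρ(x_1) = S_1 · diag(e^{πi l'_1/p_1}, e^{−πi l'_1/p_1}) · S_1^{−1} and ρ(x_j) = S_j · diag(e^{2πi l'_j/p_j}, e^{−2πi l'_j/p_j}) · S_j^{−1} for j = 2, …, n. -/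
open scoped BigOperators

noncomputable def expDiag (z : ℂ) : Matrix.SpecialLinearGroup (Fin 2) ℂ :=
  ⟨!![Complex.exp z, 0; 0, Complex.exp (-z)], by
    simp [Matrix.det_fin_two_of, ← Complex.exp_add]⟩

/-- The relations of the presentation of the fundamental group of the Seifert fibered
homology sphere `Σ(p_1,…,p_n)`: the generator `none` is the central element `h`, and
`some j` is the generator `x_j`. -/
def seifertRels (n : ℕ) (p q : Fin n → ℤ) : Set (FreeGroup (Option (Fin n))) :=
  {(List.ofFn fun j : Fin n => FreeGroup.of (some j)).prod} ∪
    (Set.range fun j : Fin n =>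
      FreeGroup.of (some j) ^ p j * FreeGroup.of (none : Option (Fin n)) ^ (-q j)) ∪
    (Set.range fun j : Fin n =>
      FreeGroup.of (some j) * FreeGroup.of (none : Option (Fin n)) *
        (FreeGroup.of (some j))⁻¹ * (FreeGroup.of (none : Option (Fin n)))⁻¹)

/-- The fundamental group of `Σ(p_1,…,p_n)`. -/
abbrev SeifertGroup (n : ℕ) (p q : Fin n → ℤ) : Type := PresentedGroup (seifertRels n p q)

/-- The generator `x_j` of the Seifert group. -/
def seifertX (n : ℕ) (p q : Fin n → ℤ) (j : Fin n) : SeifertGroup n p q :=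
  PresentedGroup.of (some j)

/-- The set `L(p_1,…,p_n)`: `0 ≤ l_1 ≤ p_1`, `0 ≤ l_j ≤ (p_j − 1)/2` for `j ≥ 2`, and
`l_j ≠ 0` for at least three indices. -/
def memL (n : ℕ) (hn : 0 < n) (p l : Fin n → ℤ) : Prop :=
  (0 ≤ l ⟨0, hn⟩ ∧ l ⟨0, hn⟩ ≤ p ⟨0, hn⟩) ∧
    (∀ j : Fin n, j ≠ ⟨0, hn⟩ → 0 ≤ l j ∧ 2 * l j ≤ p j - 1) ∧
    3 ≤ Set.ncard {j : Fin n | l j ≠ 0}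


/-- A commutative quotient of the Seifert group is trivial. -/
lemma seifert_comm_trivial {A : Type*} [CommGroup A] (n : ℕ) (p q : Fin n → ℤ)
    (hpcop : ∀ i j : Fin n, i ≠ j → IsCoprime (p i) (p j))
    (hsum : ∑ j, q j * ∏ i ∈ Finset.univ.erase j, p i = 1)
    (a : Fin n → A) (h : A) (hprod : ∏ j, a j = 1) (hrel : ∀ j, a j ^ p j = h ^ q j) :
    h = 1 ∧ ∀ j, a j = 1 := by
  have key : ∀ (s : Finset (Fin n)) (f : Fin n → ℤ), h ^ (∑ j ∈ s, f j) = ∏ j ∈ s, h ^ f j := by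
    intro s f
    induction s using Finset.induction_on with
    | empty => simp
    | insert i s hi ih => rw [Finset.sum_insert hi, Finset.prod_insert hi, zpow_add, ih]
  have hh : h = 1 := by
    have h1 : h ^ (∑ j, q j * ∏ i ∈ Finset.univ.erase j, p i) = h := by rw [hsum, zpow_one]
    rw [← h1, key]
    have : ∀ j ∈ (Finset.univ : Finset (Fin n)),
        h ^ (q j * ∏ i ∈ Finset.univ.erase j, p i) = a j ^ (∏ i, p i) := by
      intro j _
      rw [zpow_mul, ← hrel, ← zpow_mul, Finset.mul_prod_erase _ _ (Finset.mem_univ j)]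
    rw [Finset.prod_congr rfl this, Finset.prod_zpow, hprod, one_zpow]
  refine ⟨hh, fun j => ?_⟩
  have hp : ∀ j, a j ^ p j = 1 := fun j => by rw [hrel, hh, one_zpow]
  have hP : a j ^ (∏ i ∈ Finset.univ.erase j, p i) = 1 := by
    have h2 : ∏ k, a k ^ (∏ i ∈ Finset.univ.erase j, p i) = 1 := by
      rw [Finset.prod_zpow, hprod, one_zpow]
    rw [Finset.prod_eq_single j] at h2
    · exact h2
    · intro k _ hk
      have : p k ∣ ∏ i ∈ Finset.univ.erase j, p i :=
        Finset.dvd_prod_of_mem p (Finset.mem_erase.2 ⟨hk, Finset.mem_univ k⟩)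
      obtain ⟨c, hc⟩ := this
      rw [hc, zpow_mul, hp, one_zpow]
    · simp
  have hc : IsCoprime (p j) (∏ i ∈ Finset.univ.erase j, p i) :=
    IsCoprime.prod_right fun i hi => hpcop j i (Finset.ne_of_mem_erase hi).symm
  obtain ⟨u, v, huv⟩ := hc
  calc a j = a j ^ (u * p j + v * ∏ i ∈ Finset.univ.erase j, p i) := by rw [huv, zpow_one]
    _ = 1 := by
      rw [zpow_add, mul_comm u, mul_comm v, zpow_mul, zpow_mul, hp, hP, one_zpow, one_zpow, mul_one]

lemma seifert_rels (n : ℕ) (p q : Fin n → ℤ) {K : Type*} [Group K] (ρ : SeifertGroup n p q →* K) :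
    (List.ofFn fun j => ρ (seifertX n p q j)).prod = 1 ∧
    (∀ j, ρ (seifertX n p q j) ^ p j = ρ (PresentedGroup.of none) ^ q j) ∧
    (∀ j, Commute (ρ (seifertX n p q j)) (ρ (PresentedGroup.of none))) := by
  have hm : ∀ r ∈ seifertRels n p q, ρ (PresentedGroup.mk _ r) = 1 := by
    intro r hr
    rw [PresentedGroup.one_of_mem hr, map_one]
  refine ⟨?_, fun j => ?_, fun j => ?_⟩
  · have := hm _ (Or.inl (Or.inl rfl))
    rw [map_list_prod, map_list_prod, List.map_ofFn, List.map_ofFn] at this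
    exact this
  · have := hm _ (Or.inl (Or.inr ⟨j, rfl⟩))
    simp only [map_mul, map_zpow, zpow_neg, map_inv] at this
    exact mul_inv_eq_one.1 this
  · have := hm _ (Or.inr ⟨j, rfl⟩)
    simp only [map_mul, map_inv] at this
    exact mul_inv_eq_iff_eq_mul.1 (mul_inv_eq_one.1 this)

lemma seifert_abelian_trivial (n : ℕ) (p q : Fin n → ℤ)
    (hpcop : ∀ i j : Fin n, i ≠ j → IsCoprime (p i) (p j))
    (hsum : ∑ j, q j * ∏ i ∈ Finset.univ.erase j, p i = 1)
    {K : Type*} [Group K] (ρ : SeifertGroup n p q →* K)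
    (hcomm : ∀ i j, Commute (ρ (seifertX n p q i)) (ρ (seifertX n p q j))) : ρ = 1 := by
  obtain ⟨h1, h2, h3⟩ := seifert_rels n p q ρ
  let X : Set K := Set.range fun o => ρ (PresentedGroup.of o)
  have hX : ∀ x ∈ X, ∀ y ∈ X, x * y = y * x := by
    rintro _ ⟨o, rfl⟩ _ ⟨o', rfl⟩
    rcases o with _ | i <;> rcases o' with _ | j
    · rfl
    · exact (h3 j).symm
    · exact h3 i
    · exact hcomm i j
  letI := Subgroup.closureCommGroupOfComm hX
  let b : Option (Fin n) → Subgroup.closure X := fun o =>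
    ⟨ρ (PresentedGroup.of o), Subgroup.subset_closure ⟨o, rfl⟩⟩
  have := seifert_comm_trivial n p q hpcop hsum (fun j => b (some j)) (b none) (by
    rw [← List.prod_ofFn]
    apply Subtype.ext
    have e := map_list_prod (Subgroup.closure X).subtype (List.ofFn fun j => b (some j))
    rw [List.map_ofFn] at e
    exact e.trans h1) (fun j => Subtype.ext (h2 j))
  refine PresentedGroup.ext fun o => ?_
  rcases o with _ | j
  · exact congrArg Subtype.val this.1
  · exact congrArg Subtype.val (this.2 j)

lemma mem_of_prod_mem {K : Type*} [Group K] (C : Subgroup K) (n : ℕ) (f : Fin n → K)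
    (hprod : (List.ofFn f).prod ∈ C) (k : Fin n) (h : ∀ j, j ≠ k → f j ∈ C) : f k ∈ C := by
  induction n with
  | zero => exact k.elim0
  | succ n ih =>
    rw [List.ofFn_succ, List.prod_cons] at hprod
    by_cases hk : k = 0
    · subst hk
      refine (C.mul_mem_cancel_right (C.list_prod_mem fun x hx => ?_)).1 hprod
      obtain ⟨i, rfl⟩ := List.mem_ofFn.1 hx
      exact h _ (Fin.succ_ne_zero i)
    · have hmem := (C.mul_mem_cancel_left (h 0 (Ne.symm hk))).1 hprod
      obtain ⟨k, rfl⟩ := Fin.exists_succ_eq.2 hk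
      exact ih (fun i => f i.succ) hmem k
        fun j hj => h _ (fun e => hj (Fin.succ_injective _ e))

lemma mem_of_prod_one {K : Type*} [Group K] (C : Subgroup K) (n : ℕ) (f : Fin n → K)
    (hprod : (List.ofFn f).prod = 1) (k : Fin n) (h : ∀ j, j ≠ k → f j ∈ C) : f k ∈ C :=
  mem_of_prod_mem C n f (hprod ▸ C.one_mem) k h

abbrev SL2 := Matrix.SpecialLinearGroup (Fin 2) ℂ

lemma sl2_ext {A B : SL2} (h00 : A 0 0 = B 0 0) (h01 : A 0 1 = B 0 1) (h10 : A 1 0 = B 1 0)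
    (h11 : A 1 1 = B 1 1) : A = B := by
  ext i j; fin_cases i <;> fin_cases j <;> assumption

lemma sl2_mul (A B : SL2) (i j : Fin 2) : (A * B) i j = A i 0 * B 0 j + A i 1 * B 1 j := by
  rw [Matrix.SpecialLinearGroup.coe_mul, Matrix.mul_apply, Fin.sum_univ_two]

lemma sl2_det (A : SL2) : A 0 0 * A 1 1 - A 0 1 * A 1 0 = 1 := by
  have := A.2; rwa [Matrix.det_fin_two] at this

lemma commute_of_commute (A B C : SL2) (hA : Commute A C) (hB : Commute B C)
    (hC : ¬ (C 0 1 = 0 ∧ C 1 0 = 0 ∧ C 0 0 = C 1 1)) : Commute A B := by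
  have e : ∀ i j, (A * C) i j = (C * A) i j := fun i j => by rw [hA.eq]
  have f : ∀ i j, (B * C) i j = (C * B) i j := fun i j => by rw [hB.eq]
  have e00 := e 0 0; have e01 := e 0 1; have e10 := e 1 0; have e11 := e 1 1
  have f00 := f 0 0; have f01 := f 0 1; have f10 := f 1 0; have f11 := f 1 1
  simp only [sl2_mul] at e00 e01 e10 e11 f00 f01 f10 f11
  clear e f hA hB
  have h1 : A 0 1 * B 1 0 = A 1 0 * B 0 1 := by grind
  have h2 : A 0 1 * (B 0 0 - B 1 1) = (A 0 0 - A 1 1) * B 0 1 := by grind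
  have h3 : A 1 0 * (B 0 0 - B 1 1) = (A 0 0 - A 1 1) * B 1 0 := by grind
  apply sl2_ext <;> simp only [sl2_mul]
  · linear_combination h1
  · linear_combination -h2
  · linear_combination h3
  · linear_combination -h1

lemma sq_one_of_scalar (C : SL2) (h : C 0 1 = 0 ∧ C 1 0 = 0 ∧ C 0 0 = C 1 1) : C ^ 2 = 1 := by
  obtain ⟨h1, h2, h3⟩ := h
  have := sl2_det C
  rw [h1, h2, h3] at this
  rw [sq]
  apply sl2_ext <;> simp only [sl2_mul, h1, h2, h3] <;> simp <;> linear_combination this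

lemma sl2_inv10 (A : SL2) : (A⁻¹) 1 0 = -A 1 0 := by
  rw [Matrix.SpecialLinearGroup.coe_inv, Matrix.adjugate_fin_two]; simp

lemma sl2_inv11 (A : SL2) : (A⁻¹) 1 1 = A 0 0 := by
  rw [Matrix.SpecialLinearGroup.coe_inv, Matrix.adjugate_fin_two]; simp

lemma exists_sl2 (a b c d : ℂ) (h : a * d - b * c = 1) :
    ∃ S : SL2, S 0 0 = a ∧ S 0 1 = b ∧ S 1 0 = c ∧ S 1 1 = d :=
  ⟨⟨!![a, b; c, d], by rw [Matrix.det_fin_two_of, h]⟩, rfl, rfl, rfl, rfl⟩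

lemma exists_triangular (A : SL2) : ∃ S : SL2, (S⁻¹ * A * S) 1 0 = 0 := by
  by_cases hc : A 1 0 = 0
  · exact ⟨1, by simpa using hc⟩
  · obtain ⟨r, hr⟩ := IsAlgClosed.exists_pow_nat_eq ((A 0 0 + A 1 1) ^ 2 - 4) (n := 2) (by norm_num)
    have hd := sl2_det A
    set l := ((A 0 0 + A 1 1) + r) / 2 with hl
    have hq : l ^ 2 - (A 0 0 + A 1 1) * l + 1 = 0 := by
      rw [hl]; linear_combination hr / 4
    obtain ⟨S, s00, s01, s10, s11⟩ := exists_sl2 (l - A 1 1) (-1 / A 1 0) (A 1 0) 0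
      (by field_simp; ring)
    refine ⟨S, ?_⟩
    simp only [sl2_mul, sl2_inv10, sl2_inv11, s00, s10]
    linear_combination (A 1 0) * (hq + hd)

lemma triangular_pow (B : SL2) (h : B 1 0 = 0) (k : ℕ) :
    (B ^ k) 1 0 = 0 ∧ (B ^ k) 0 0 = B 0 0 ^ k ∧
    (B 0 0 = B 1 1 → (B ^ k) 0 1 * B 0 0 = k * B 0 0 ^ k * B 0 1) := by
  induction k with
  | zero => simp
  | succ k ih =>
    obtain ⟨h1, h2, h3⟩ := ih
    simp only [pow_succ (B), sl2_mul]
    refine ⟨by rw [h1, h]; ring, by rw [h2, h]; ring, fun e => ?_⟩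
    have := h3 e
    rw [h2, ← e]
    push_cast
    linear_combination B 0 0 * this

lemma expDiag_apply (z : ℂ) : expDiag z 0 0 = Complex.exp z ∧ expDiag z 0 1 = 0 ∧
    expDiag z 1 0 = 0 ∧ expDiag z 1 1 = (Complex.exp z)⁻¹ :=
  ⟨rfl, rfl, rfl, Complex.exp_neg z⟩

lemma diagonalize (A : SL2) (N : ℕ) (hN : 0 < N) (hA : A ^ N = 1) :
    ∃ (S : SL2) (l : ℤ), A = S * expDiag (2 * (Real.pi : ℂ) * Complex.I * (l : ℂ) / (N : ℂ)) * S⁻¹ := by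
  obtain ⟨S, hS⟩ := exists_triangular A
  set B := S⁻¹ * A * S with hB
  have hBN : B ^ N = 1 := by
    have : B = S⁻¹ * A * (S⁻¹)⁻¹ := by rw [hB, inv_inv]
    rw [this, conj_pow, hA]; simp
  obtain ⟨-, h2, h3⟩ := triangular_pow B hS N
  have hd := sl2_det B
  rw [hS] at hd
  have haN : B 0 0 ^ N = 1 := by rw [← h2, hBN]; simp
  have hT : ∃ c : ℂ, B 0 1 = c * (B 1 1 - B 0 0) := by
    by_cases e : B 0 0 = B 1 1
    · have := h3 e
      rw [hBN, haN] at this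
      have hN' : (N : ℂ) ≠ 0 := by exact_mod_cast hN.ne'
      simp [hN'] at this
      exact ⟨0, by simp [this]⟩
    · refine ⟨B 0 1 / (B 1 1 - B 0 0), ?_⟩
      rw [div_mul_cancel₀]
      exact sub_ne_zero.2 (Ne.symm e)
  obtain ⟨c, hc⟩ := hT
  haveI : NeZero N := ⟨hN.ne'⟩
  obtain ⟨l, -, hl⟩ := (Complex.isPrimitiveRoot_exp N hN.ne').eq_pow_of_pow_eq_one haN
  rw [← Complex.exp_nat_mul] at hl
  have hz : (l : ℂ) * (2 * (Real.pi : ℂ) * Complex.I / N) =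
      2 * (Real.pi : ℂ) * Complex.I * ((l : ℤ) : ℂ) / (N : ℂ) := by push_cast; ring
  rw [hz] at hl
  obtain ⟨T, t00, t01, t10, t11⟩ := exists_sl2 1 c 0 1 (by ring)
  refine ⟨S * T, l, ?_⟩
  have hBT : B = T * expDiag (2 * (Real.pi : ℂ) * Complex.I * ((l : ℤ) : ℂ) / (N : ℂ)) * T⁻¹ := by
    rw [eq_mul_inv_iff_mul_eq]
    have ha0 : B 0 0 ≠ 0 := by intro h0; simp [h0] at hd
    have h11 : B 1 1 = (B 0 0)⁻¹ := by
      field_simp; linear_combination hd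
    obtain ⟨d00, d01, d10, d11⟩ :=
      expDiag_apply (2 * (Real.pi : ℂ) * Complex.I * ((l : ℤ) : ℂ) / (N : ℂ))
    rw [hl] at d00 d11
    apply sl2_ext <;> simp only [sl2_mul, t00, t01, t10, t11, d00, d01, d10, d11, hS, hc, h11] <;> ring
  rw [mul_inv_rev]
  calc A = S * B * S⁻¹ := by rw [hB]; group
    _ = _ := by rw [hBT]; group

lemma expDiag_central (z : ℂ) (hz : Complex.exp z = Complex.exp (-z)) (S B : SL2) :
    Commute (S * expDiag z * S⁻¹) B := by
  have h : ∀ C : SL2, expDiag z * C = C * expDiag z := by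
    intro C
    apply sl2_ext <;> simp only [sl2_mul] <;> simp [expDiag, ← hz] <;> ring
  rw [← h, mul_inv_cancel_right]
  exact h B

theorem statement2 (n : ℕ) (hn : 3 ≤ n) (p q : Fin n → ℤ)
    (hp2 : ∀ j, 2 ≤ p j)
    (hpcop : ∀ i j : Fin n, i ≠ j → IsCoprime (p i) (p j))
    (hpodd : ∀ j : Fin n, j ≠ ⟨0, by omega⟩ → Odd (p j))
    (hqcop : ∀ j, IsCoprime (p j) (q j))
    (hq1odd : Odd (q ⟨0, by omega⟩))
    (hqeven : ∀ j : Fin n, j ≠ ⟨0, by omega⟩ → Even (q j))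
    (hsum : ∑ j, q j * ∏ i ∈ Finset.univ.erase j, p i = 1)
    (ρ : SeifertGroup n p q →* Matrix.SpecialLinearGroup (Fin 2) ℂ)
    (hρ : ρ ≠ 1) :
    ∃ (l' : Fin n → ℤ) (S : Fin n → Matrix.SpecialLinearGroup (Fin 2) ℂ),
      Set.ncard {j : Fin n | p j ∣ l' j} ≤ n - 3 ∧
      ρ (seifertX n p q ⟨0, by omega⟩) =
        S ⟨0, by omega⟩ *
          expDiag ((Real.pi : ℂ) * Complex.I * (l' ⟨0, by omega⟩ : ℂ) / (p ⟨0, by omega⟩ : ℂ)) *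
          (S ⟨0, by omega⟩)⁻¹ ∧
      ∀ j : Fin n, j ≠ ⟨0, by omega⟩ →
        ρ (seifertX n p q j) =
          S j * expDiag (2 * (Real.pi : ℂ) * Complex.I * (l' j : ℂ) / (p j : ℂ)) * (S j)⁻¹ := by
  obtain ⟨h1, h2, h3⟩ := seifert_rels n p q ρ
  set X : Fin n → SL2 := fun j => ρ (seifertX n p q j) with hX
  set H : SL2 := ρ (PresentedGroup.of none) with hH
  have hnc : ¬ ∀ i j, Commute (X i) (X j) := fun h =>
    hρ (seifert_abelian_trivial n p q hpcop hsum ρ h)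
  have hH2 : H ^ 2 = 1 := by
    apply sq_one_of_scalar
    by_contra hC
    exact hnc fun i j => commute_of_commute _ _ H (h3 i) (h3 j) hC
  have hH2z : H ^ (2 : ℤ) = 1 := by exact_mod_cast hH2
  have hdiag0 : ∃ (S : SL2) (l : ℤ), X ⟨0, by omega⟩ =
      S * expDiag ((Real.pi : ℂ) * Complex.I * (l : ℂ) / (p ⟨0, by omega⟩ : ℂ)) * S⁻¹ := by
    have hp := hp2 ⟨0, by omega⟩
    obtain ⟨m, hm⟩ := Int.eq_ofNat_of_zero_le (by omega : 0 ≤ p ⟨0, by omega⟩)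
    obtain ⟨S, l, h⟩ := diagonalize (X ⟨0, by omega⟩) (2 * m) (by omega) (by
      have e : X ⟨0, by omega⟩ ^ (m : ℤ) = H ^ q ⟨0, by omega⟩ := by
        rw [← hm]; exact h2 _
      rw [zpow_natCast] at e
      rw [mul_comm, pow_mul, e, ← zpow_natCast, ← zpow_mul, mul_comm, zpow_mul]
      push_cast
      rw [hH2z, one_zpow])
    refine ⟨S, l, h.trans ?_⟩
    rw [hm]
    congr 3
    push_cast
    rw [mul_assoc, mul_assoc, mul_div_mul_left _ _ (two_ne_zero), mul_assoc]
  have hdiag : ∀ j : Fin n, j ≠ ⟨0, by omega⟩ → ∃ (S : SL2) (l : ℤ), X j =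
      S * expDiag (2 * (Real.pi : ℂ) * Complex.I * (l : ℂ) / (p j : ℂ)) * S⁻¹ := by
    intro j hj
    have hp := hp2 j
    obtain ⟨m, hm⟩ := Int.eq_ofNat_of_zero_le (by omega : 0 ≤ p j)
    obtain ⟨S, l, h⟩ := diagonalize (X j) m (by omega) (by
      have e : X j ^ (m : ℤ) = H ^ q j := by
        rw [← hm]; exact h2 _
      rw [zpow_natCast] at e
      obtain ⟨r, hr⟩ := hqeven j hj
      rw [e, hr, ← two_mul, zpow_mul, hH2z, one_zpow])
    refine ⟨S, l, h.trans ?_⟩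
    rw [hm]
    push_cast
    rfl
  have hall : ∀ j : Fin n, ∃ (S : SL2) (l : ℤ),
      (j = ⟨0, by omega⟩ → X j =
        S * expDiag ((Real.pi : ℂ) * Complex.I * (l : ℂ) / (p j : ℂ)) * S⁻¹) ∧
      (j ≠ ⟨0, by omega⟩ → X j =
        S * expDiag (2 * (Real.pi : ℂ) * Complex.I * (l : ℂ) / (p j : ℂ)) * S⁻¹) := by
    intro j
    by_cases hj : j = ⟨0, by omega⟩
    · subst hj
      obtain ⟨S, l, h⟩ := hdiag0
      exact ⟨S, l, fun _ => h, fun h => absurd rfl h⟩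
    · obtain ⟨S, l, h⟩ := hdiag j hj
      exact ⟨S, l, fun h => absurd h hj, fun _ => h⟩
  choose S l hl0 hl1 using hall
  refine ⟨l, S, ?_, hl0 _ rfl, fun j hj => hl1 j hj⟩
  have hcentral : ∀ j, p j ∣ l j → ∀ B, Commute (X j) B := by
    rintro j ⟨m, hm⟩ B
    have hpj : (p j : ℂ) ≠ 0 := by
      have := hp2 j
      exact_mod_cast (by omega : p j ≠ 0)
    by_cases hj : j = ⟨0, by omega⟩
    · rw [hl0 j hj]
      apply expDiag_central
      rw [Complex.exp_eq_exp_iff_exists_int, hm]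
      refine ⟨m, ?_⟩
      push_cast
      field_simp
      ring
    · rw [hl1 j hj]
      apply expDiag_central
      rw [Complex.exp_eq_exp_iff_exists_int, hm]
      refine ⟨2 * m, ?_⟩
      push_cast
      field_simp
      ring
  by_contra hcard
  apply hnc
  have hcompl : Set.ncard {j : Fin n | p j ∣ l j}ᶜ ≤ 2 := by
    have := Set.ncard_add_ncard_compl {j : Fin n | p j ∣ l j}
    rw [Nat.card_eq_fintype_card, Fintype.card_fin] at this
    omega
  intro i j
  by_cases hi : p i ∣ l i
  · exact hcentral i hi _
  by_cases hj : p j ∣ l j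
  · exact (hcentral j hj _).symm
  by_cases hij : i = j
  · subst hij; exact Commute.refl _
  have hmem := mem_of_prod_one (Subgroup.centralizer {X i}) n X h1 j (by
    intro k hkj
    rw [Subgroup.mem_centralizer_singleton_iff]
    by_cases hki : k = i
    · rw [hki]
    · by_cases hk : p k ∣ l k
      · first
        | exact hcentral k hk _
        | exact (hcentral k hk _).symm
      · exfalso
        have hsub : (({i, j, k} : Finset (Fin n)) : Set (Fin n)) ⊆ {j : Fin n | p j ∣ l j}ᶜ := by
          intro x hx
          simp at hx
          rcases hx with rfl | rfl | rfl <;> assumption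
        have := Set.ncard_le_ncard hsub
        rw [Set.ncard_coe_finset, Finset.card_eq_three.2
          ⟨i, j, k, hij, Ne.symm hki, Ne.symm hkj, rfl⟩] at this
        omega)
  rw [Subgroup.mem_centralizer_singleton_iff] at hmem
  first
  | exact hmem
  | exact hmem.symm
end

section
/- Let d ≥ 0 be an integer, let q_0, …, q_d ∈ ℂ and Q(x) = Σ_{u=0}^d q_u x^u. Then for every integer N ≥ 0, as t → 0 through positive reals, Σ_{m=1}^∞ e^{−t m²} C(m) Q(m) = Σ_{u=0}^d Σ_{r=0}^N q_u · Λ(2r + u) · (−t)^r/r! + O(t^{N+1}), where Λ(s) := −(M^s/(s + 1)) · Σ_{m=1}^M C(m) B_{s+1}(m/M) for integers s ≥ 0. -/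
open scoped BigOperators
open Asymptotics Filter

/-- `Λ(s) = −(M^s/(s + 1)) · Σ_{m=1}^M C(m) B_{s+1}(m/M)`, the value `L(−s, C)` of the
analytic continuation of the L-series of `C`. -/
noncomputable def LambdaVal (M : ℕ) (C : ℤ → ℂ) (s : ℕ) : ℂ :=
  -((M : ℂ) ^ s / ((s : ℂ) + 1)) *
    ∑ m ∈ Finset.Icc (1 : ℤ) (M : ℤ),
      C m * Polynomial.aeval ((m : ℂ) / (M : ℂ)) (Polynomial.bernoulli (s + 1))

namespace S8

open Polynomial

lemma sum_Icc (f : ℤ → ℂ) (n : ℕ) : ∑ m ∈ Finset.Icc (1 : ℤ) (n : ℤ), f m = ∑ i ∈ Finset.range n, f ((i:ℤ)+1) := by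
  induction n with
  | zero => simp
  | succ n ih =>
    rw [Finset.sum_range_succ, ← ih]
    have : Finset.Icc (1:ℤ) ((n+1:ℕ):ℤ) = insert ((n:ℤ)+1) (Finset.Icc (1:ℤ) (n:ℤ)) := by
      ext x; simp; omega
    rw [this, Finset.sum_insert (by simp), add_comm]

/-- real value of Bernoulli polynomial -/
noncomputable def bR (k : ℕ) (x : ℝ) : ℝ := Polynomial.aeval x (Polynomial.bernoulli k)

lemma bR_sum (n : ℕ) (x : ℝ) : ∑ k ∈ Finset.range n, ((n+1).choose (k+1) : ℝ) * bR (k+1) x = (n+1) * x^n - 1 := by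
  have := congrArg (fun p => Polynomial.aeval x p) (Polynomial.sum_bernoulli n)
  simp only [map_sum, Polynomial.aeval_monomial, map_smul] at this
  rw [Finset.sum_range_succ'] at this
  simp at this
  simp only [bR]
  simp [Algebra.smul_def] at this
  linarith

/-- The Euler-Maclaurin functional. -/
noncomputable def EM (K : ℕ) (x : ℝ) (G : ℕ → ℝ → ℝ) : ℝ :=
  G 0 x - ∑ k ∈ Finset.range K, bR (k+1) x / ((k+1).factorial : ℝ) * (G k 1 - G k 0)

lemma EM_monomial (K n : ℕ) (hn : n < K) (x : ℝ) :
    EM K x (fun k y => (derivative^[k] (X^n : ℝ[X])).eval y) = 1 / (n+1) := by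
  unfold EM
  have h : ∀ k ∈ Finset.range K, bR (k+1) x / ((k+1).factorial : ℝ) * ((derivative^[k] (X^n : ℝ[X])).eval 1 - (derivative^[k] (X^n : ℝ[X])).eval 0) = if k ∈ Finset.range n then 1/(n+1) * (((n+1).choose (k+1) : ℝ) * bR (k+1) x) else 0 := by
    intro k hk
    rw [Polynomial.iterate_derivative_X_pow_eq_natCast_mul]
    simp only [Polynomial.eval_mul, Polynomial.eval_natCast, Polynomial.eval_pow, Polynomial.eval_X, one_pow, mul_one, Finset.mem_range]
    split_ifs with h
    · rw [zero_pow (by omega)]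
      have e1 : ((n+1).choose (k+1) : ℝ) * (k+1).factorial = (n+1) * n.descFactorial k := by
        have := Nat.descFactorial_eq_factorial_mul_choose (n+1) (k+1)
        rw [Nat.succ_descFactorial_succ] at this
        have : (((n+1) * n.descFactorial k : ℕ):ℝ) = _ := congrArg _ this
        push_cast at this
        rw [this]; ring
      have : ((k+1).factorial : ℝ) ≠ 0 := by positivity
      field_simp
      linear_combination (-bR (k+1) x) * e1
    · rcases Nat.eq_or_lt_of_not_lt h with h | h
      · subst h; simp
      · simp [Nat.descFactorial_eq_zero_iff_lt.2 h]
  rw [Finset.sum_congr rfl h, Finset.sum_ite_mem, Finset.inter_eq_right.2 (by simpa using hn.le), ← Finset.mul_sum, bR_sum]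
  simp
  field_simp
  ring

lemma EM_poly (K : ℕ) (c : ℕ → ℝ) (x : ℝ) :
    EM K x (fun k y => (derivative^[k] (∑ n ∈ Finset.range K, Polynomial.C (c n) * X^n : ℝ[X])).eval y) = ∑ n ∈ Finset.range K, c n / (n+1) := by
  have := Finset.sum_congr (rfl : Finset.range K = _) (fun n hn => congrArg (fun z => c n * z) (EM_monomial K n (Finset.mem_range.1 hn) x))
  simp only [mul_one_div] at this
  rw [← this]
  simp only [EM, mul_sub, Finset.sum_sub_distrib, Polynomial.iterate_derivative_sum, Polynomial.eval_finsetSum, Polynomial.iterate_derivative_C_mul, Polynomial.eval_mul, Polynomial.eval_C, Finset.mul_sum]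
  congr 2
  · rw [Finset.sum_comm]; refine Finset.sum_congr rfl fun _ _ => Finset.sum_congr rfl fun _ _ => by ring
  · rw [Finset.sum_comm]; refine Finset.sum_congr rfl fun _ _ => Finset.sum_congr rfl fun _ _ => by ring

lemma chain_bound (K : ℕ) (R : ℕ → ℝ → ℝ) (A : ℝ) (hA : 0 ≤ A)
    (hd : ∀ k y, HasDerivAt (R k) (R (k+1) y) y)
    (h0 : ∀ k < K, R k 0 = 0) (hK : ∀ y ∈ Set.Icc (0:ℝ) 1, |R K y| ≤ A) (k : ℕ) (hk : k ≤ K) :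
    ∀ y ∈ Set.Icc (0:ℝ) 1, |R k y| ≤ A := by
  induction hk using Nat.decreasingInduction with
  | self => exact hK
  | of_succ k hk ih =>
    intro y hy
    have := Convex.norm_image_sub_le_of_norm_hasDerivWithin_le (s := Set.Icc (0:ℝ) 1) (f := R k) (f' := R (k+1)) (C := A) (x := 0) (y := y) (fun z _ => (hd k z).hasDerivWithinAt) ih (convex_Icc 0 1) (by simp) hy
    rw [h0 k hk] at this
    simp only [sub_zero, Real.norm_eq_abs] at this
    refine this.trans ?_
    rw [abs_of_nonneg hy.1]
    nlinarith [hy.2]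

lemma EM_bound (K : ℕ) (x : ℝ) (hx : x ∈ Set.Icc (0:ℝ) 1) : ∃ c : ℝ, 0 ≤ c ∧ ∀ (G : ℕ → ℝ → ℝ) (A : ℝ), 0 ≤ A → 
    (∀ k y, HasDerivAt (G k) (G (k+1) y) y) → (∀ y ∈ Set.Icc (0:ℝ) 1, |G K y| ≤ A) →
    |EM K x G - ∑ n ∈ Finset.range K, (G n 0 / n.factorial) / (n+1)| ≤ c * A := by
  refine ⟨1 + ∑ k ∈ Finset.range K, |bR (k+1) x / ((k+1).factorial : ℝ)| * 2, by positivity, ?_⟩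
  intro G A hA hd hK
  set T : ℝ[X] := ∑ n ∈ Finset.range K, Polynomial.C (G n 0 / n.factorial) * X^n with hT
  have hTc : ∀ n, T.coeff n = if n < K then G n 0 / n.factorial else 0 := by
    intro n; simp [hT, Polynomial.coeff_X_pow]
  let R : ℕ → ℝ → ℝ := fun k y => G k y - (derivative^[k] T).eval y
  have hR : EM K x R = EM K x G - ∑ n ∈ Finset.range K, (G n 0 / n.factorial) / (n+1) := by
    rw [← EM_poly K (fun n => G n 0 / n.factorial) x, ← hT]
    simp only [EM, R, mul_sub, Finset.sum_sub_distrib]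
    ring
  have hRd : ∀ k y, HasDerivAt (R k) (R (k+1) y) y := by
    intro k y
    have := (hd k y).sub ((derivative^[k] T).hasDerivAt y)
    simp only [R, Function.iterate_succ_apply']
    exact this
  have hb : ∀ k ≤ K, ∀ y ∈ Set.Icc (0:ℝ) 1, |R k y| ≤ A := by
    refine chain_bound K R A hA hRd ?_ ?_
    · intro k hk
      simp only [R]
      rw [← Polynomial.coeff_zero_eq_eval_zero, Polynomial.coeff_iterate_derivative]
      simp [hTc, hk]
      have : (k.factorial : ℝ) ≠ 0 := by positivity
      field_simp; simp [Nat.descFactorial_self]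
    · have : derivative^[K] T = 0 := by
        ext n
        rw [Polynomial.coeff_iterate_derivative, hTc]
        simp
      simpa [R, this] using hK
  rw [← hR, add_mul, Finset.sum_mul, one_mul]
  refine (abs_sub _ _).trans (add_le_add (hb 0 (Nat.zero_le _) x hx) ?_)
  refine (Finset.abs_sum_le_sum_abs _ _).trans (Finset.sum_le_sum fun k hk => ?_)
  rw [abs_mul, mul_assoc]
  gcongr
  have := hb k (Finset.mem_range.1 hk).le
  have h1 := this 1 (by simp)
  have h2 := this 0 (by simp)
  refine (abs_sub _ _).trans (by linarith)

lemma block_bound (M : ℕ) (hM : 0 < M) (c : ℕ → ℂ) (hc : ∑ i ∈ Finset.range M, c i = 0) (K : ℕ) :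
    ∃ D : ℝ, 0 ≤ D ∧ ∀ (G : ℕ → ℝ → ℝ) (A : ℝ), 0 ≤ A → 
    (∀ k y, HasDerivAt (G k) (G (k+1) y) y) → (∀ y ∈ Set.Icc (0:ℝ) 1, |G K y| ≤ A) →
    ‖∑ i ∈ Finset.range M, c i * (EM K (((i:ℝ)+1)/M) G : ℂ)‖ ≤ D * A := by
  have hx : ∀ i : ℕ, ∃ b : ℝ, 0 ≤ b ∧ (i < M → ∀ (G : ℕ → ℝ → ℝ) (A : ℝ), 0 ≤ A → 
    (∀ k y, HasDerivAt (G k) (G (k+1) y) y) → (∀ y ∈ Set.Icc (0:ℝ) 1, |G K y| ≤ A) →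
    |EM K (((i:ℝ)+1)/M) G - ∑ n ∈ Finset.range K, (G n 0 / n.factorial) / (n+1)| ≤ b * A) := by
    intro i
    by_cases hi : i < M
    · obtain ⟨b, hb, h⟩ := EM_bound K (((i:ℝ)+1)/M) ⟨by positivity, by
        rw [div_le_one (by positivity)]; exact_mod_cast hi⟩
      exact ⟨b, hb, fun _ => h⟩
    · exact ⟨0, le_rfl, fun h => absurd h hi⟩
  choose b hb h using hx
  refine ⟨∑ i ∈ Finset.range M, ‖c i‖ * b i, Finset.sum_nonneg fun i _ => mul_nonneg (norm_nonneg _) (hb i), ?_⟩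
  intro G A hA hd hK
  set I : ℝ := ∑ n ∈ Finset.range K, (G n 0 / n.factorial) / (n+1)
  have : ∑ i ∈ Finset.range M, c i * (EM K (((i:ℝ)+1)/M) G : ℂ) = ∑ i ∈ Finset.range M, c i * ((EM K (((i:ℝ)+1)/M) G - I : ℝ) : ℂ) := by
    simp only [Complex.ofReal_sub, mul_sub, Finset.sum_sub_distrib, ← Finset.sum_mul, hc]
    simp
  rw [this, Finset.sum_mul]
  refine (norm_sum_le _ _).trans (Finset.sum_le_sum fun i hi => ?_)
  rw [norm_mul, Complex.norm_real, mul_assoc]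
  exact mul_le_mul_of_nonneg_left (h i (Finset.mem_range.1 hi) G A hA hd hK) (norm_nonneg _)

noncomputable def beta (M : ℕ) (c : ℕ → ℂ) (k : ℕ) : ℂ :=
  ∑ i ∈ Finset.range M, c i * ((bR (k+1) (((i:ℝ)+1)/M) / ((k+1).factorial : ℝ) : ℝ) : ℂ)

lemma sum_EM (M : ℕ) (c : ℕ → ℂ) (K : ℕ) (G : ℕ → ℝ → ℝ) :
    ∑ i ∈ Finset.range M, c i * (EM K (((i:ℝ)+1)/M) G : ℂ) = 
    ∑ i ∈ Finset.range M, c i * (G 0 (((i:ℝ)+1)/M) : ℂ) - ∑ k ∈ Finset.range K, beta M c k * ((G k 1 : ℂ) - G k 0) := by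
  simp only [EM, beta, Complex.ofReal_sub, Complex.ofReal_sum, Complex.ofReal_mul, mul_sub, Finset.sum_sub_distrib, Finset.mul_sum, Finset.sum_mul]
  congr 2
  · rw [Finset.sum_comm]; refine Finset.sum_congr rfl fun _ _ => Finset.sum_congr rfl fun _ _ => by ring
  · rw [Finset.sum_comm]; refine Finset.sum_congr rfl fun _ _ => Finset.sum_congr rfl fun _ _ => by ring

lemma sum_blocks (M : ℕ) (f : ℕ → ℂ) (J : ℕ) :
    ∑ n ∈ Finset.range (J * M), f n = ∑ j ∈ Finset.range J, ∑ i ∈ Finset.range M, f (j * M + i) := by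
  induction J with
  | zero => simp
  | succ J ih => rw [add_mul, one_mul, Finset.sum_range_add, ih, Finset.sum_range_succ]

lemma summable_sq : Summable (fun j : ℕ => 1 / (1 + (j:ℝ)^2)) := by
  rw [← summable_nat_add_iff 1]
  refine Summable.of_nonneg_of_le (fun j => by positivity) (fun j => ?_) ((summable_nat_add_iff 1).2 (Real.summable_one_div_nat_pow.2 (le_refl 2)))
  apply one_div_le_one_div_of_le <;> [positivity; linarith]

lemma bounded_c (M : ℕ) (hM : 0 < M) (c : ℕ → ℂ) (hper : ∀ i, c (i + M) = c i) : ∃ B, ∀ n, ‖c n‖ ≤ B := by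
  refine ⟨∑ i ∈ Finset.range M, ‖c i‖, fun n => ?_⟩
  have : c n = c (n % M) := by
    have h : Function.Periodic c M := hper
    exact (h.map_mod_nat n).symm
  rw [this]
  exact Finset.single_le_sum (f := fun i => ‖c i‖) (fun _ _ => norm_nonneg _) (Finset.mem_range.2 (Nat.mod_lt _ hM))

lemma summable_main (M : ℕ) (hM : 0 < M) (c : ℕ → ℂ) (hper : ∀ i, c (i + M) = c i)
    (g : ℝ → ℝ) (A : ℝ) (hA : ∀ x, |g x| ≤ A / (1 + x^2)) (w : ℝ) (hw : 0 < w) (hw1 : w ≤ 1) :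
    Summable (fun n : ℕ => c n * (g (w * ((n:ℝ)+1)) : ℂ)) := by
  obtain ⟨B, hB⟩ := bounded_c M hM c hper
  have hA0 : 0 ≤ A := by simpa using (abs_nonneg _).trans (hA 0)
  have hB0 : 0 ≤ B := (norm_nonneg _).trans (hB 0)
  refine Summable.of_norm_bounded (summable_sq.mul_left (B * (A / w^2))) fun n => ?_
  rw [norm_mul, Complex.norm_real, mul_assoc]
  refine mul_le_mul (hB n) ((hA _).trans ?_) (abs_nonneg _) hB0
  rw [div_mul_div_comm, mul_one]
  apply div_le_div_of_nonneg_left hA0 (by positivity)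
  have : 0 ≤ (n:ℝ) := by positivity
  have h2 : w^2 ≤ 1 := by nlinarith
  nlinarith [mul_nonneg (sq_nonneg w) this]

lemma main_EM (M : ℕ) (hM : 0 < M) (c : ℕ → ℂ) (hper : ∀ i, c (i + M) = c i)
    (hc : ∑ i ∈ Finset.range M, c i = 0) (h : ℕ → ℝ → ℝ)
    (hd : ∀ k y, HasDerivAt (h k) (h (k+1) y) y) (A : ℕ → ℝ) (hA : ∀ k x, |h k x| ≤ A k / (1 + x^2)) (K : ℕ) :
    ∃ E : ℝ, ∀ w : ℝ, 0 < w → M * w ≤ 1 → 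
    ‖∑' n : ℕ, c n * (h 0 (w * ((n:ℝ)+1)) : ℂ) + ∑ k ∈ Finset.range (K+2), beta M c k * (M * w)^k * h k 0‖ ≤ E * w^K := by
  obtain ⟨D, hD, hblock⟩ := block_bound M hM c hc (K+2)
  have hA0 : ∀ k, 0 ≤ A k := fun k => by simpa using (abs_nonneg _).trans (hA k 0)
  have hM1 : (1:ℝ) ≤ M := by exact_mod_cast hM
  refine ⟨D * (A (K+2) * M^K * ∑' j : ℕ, 1 / (1 + (j:ℝ)^2)), fun w hw hMw => ?_⟩
  have hw1 : w ≤ 1 := by nlinarith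
  set s : ℝ := M * w with hs
  have hs0 : 0 < s := by positivity
  let G : ℕ → ℕ → ℝ → ℝ := fun j k y => s^k * h k (s * (j + y))
  have hG : ∀ j k y, HasDerivAt (G j k) (G j (k+1) y) y := by
    intro j k y
    have h1 : HasDerivAt (fun y : ℝ => s * ((j:ℝ) + y)) s y := by
      simpa using ((hasDerivAt_id y).const_add (j:ℝ)).const_mul s
    have := ((hd k (s * (j + y))).comp y h1).const_mul (s^k)
    exact this.congr_deriv (by simp only [G]; ring)
  have hGb : ∀ (j : ℕ), ∀ y ∈ Set.Icc (0:ℝ) 1, |G j (K+2) y| ≤ s^K * A (K+2) * (1 / (1 + (j:ℝ)^2)) := by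
    intro j y hy
    simp only [G]
    rw [abs_mul, abs_of_nonneg (by positivity)]
    have h1 : A (K+2) / (1 + (s * (j+y))^2) ≤ A (K+2) / (s^2 * (1 + (j:ℝ)^2)) := by
      apply div_le_div_of_nonneg_left (hA0 _) (by positivity)
      have : 0 ≤ (j:ℝ) := by positivity
      have h2 : s^2 ≤ 1 := by nlinarith
      have h3 : (j:ℝ)^2 ≤ (j+y)^2 := by nlinarith [hy.1]
      nlinarith [mul_le_mul_of_nonneg_left h3 (sq_nonneg s)]
    calc s^(K+2) * |h (K+2) (s * (j+y))| ≤ s^(K+2) * (A (K+2) / (s^2 * (1 + (j:ℝ)^2))) := by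
          gcongr; exact (hA _ _).trans h1
      _ = _ := by field_simp; ring
  have hpart : ∀ J : ℕ, ‖∑ n ∈ Finset.range (J * M), c n * (h 0 (w * ((n:ℝ)+1)) : ℂ) - ∑ k ∈ Finset.range (K+2), beta M c k * ((s^k * h k (s * J) : ℝ) - (s^k * h k 0 : ℝ) : ℂ)‖ ≤ D * (A (K+2) * M^K * ∑' j : ℕ, 1 / (1 + (j:ℝ)^2)) * w^K := by
    intro J
    have e : ∑ n ∈ Finset.range (J * M), c n * (h 0 (w * ((n:ℝ)+1)) : ℂ) - ∑ k ∈ Finset.range (K+2), beta M c k * ((s^k * h k (s * J) : ℝ) - (s^k * h k 0 : ℝ) : ℂ) = ∑ j ∈ Finset.range J, ∑ i ∈ Finset.range M, c i * (EM (K+2) (((i:ℝ)+1)/M) (G j) : ℂ) := by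
      simp only [sum_EM]
      rw [sum_blocks, Finset.sum_sub_distrib]
      congr 1
      · refine Finset.sum_congr rfl fun j _ => Finset.sum_congr rfl fun i _ => ?_
        have : c (j * M + i) = c i := by
          have hp : Function.Periodic c M := hper
          rw [add_comm]; simpa using hp.nat_mul j i
        rw [this]
        simp only [G, pow_zero, one_mul]
        have e2 : w * (((j * M + i : ℕ) : ℝ) + 1) = s * ((j:ℝ) + ((i:ℝ)+1)/M) := by
          push_cast
          rw [hs]; field_simp; ring
        rw [e2]
      · rw [Finset.sum_comm]
        refine Finset.sum_congr rfl fun k _ => ?_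
        rw [← Finset.mul_sum]
        congr 1
        have := Finset.sum_range_sub (fun j : ℕ => ((s^k * h k (s * j) : ℝ) : ℂ)) J
        simp only [Nat.cast_zero, mul_zero] at this
        rw [← this]
        simp [G]
    rw [e]
    refine (norm_sum_le _ _).trans ((Finset.sum_le_sum fun j _ => hblock (G j) _ (by have := hA0 (K+2); positivity) (hG j) (hGb j)).trans ?_)
    rw [← Finset.mul_sum, ← Finset.mul_sum, mul_assoc D]
    refine mul_le_mul_of_nonneg_left ?_ hD
    have := summable_sq.sum_le_tsum (Finset.range J) (fun i _ => by positivity)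
    calc _ ≤ s^K * A (K+2) * ∑' j : ℕ, 1 / (1 + (j:ℝ)^2) := mul_le_mul_of_nonneg_left this (by have := hA0 (K+2); positivity)
      _ = _ := by rw [hs, mul_pow]; ring
  have hsum := (summable_main M hM c hper (h 0) (A 0) (hA 0) w hw hw1).hasSum.tendsto_sum_nat
  have hJ : Tendsto (fun J : ℕ => J * M) atTop atTop := tendsto_id.atTop_mul_const' hM
  have hlim : ∀ k, Tendsto (fun J : ℕ => ((s^k * h k (s * J) : ℝ) : ℂ)) atTop (nhds ((0:ℝ):ℂ)) := by
    intro k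
    refine (Complex.continuous_ofReal.tendsto 0).comp ?_
    have : Tendsto (fun x => h k x) atTop (nhds 0) := by
      refine squeeze_zero_norm (hA k) ?_
      refine Tendsto.div_atTop tendsto_const_nhds ?_
      exact tendsto_atTop_add_const_left _ _ (tendsto_pow_atTop (by norm_num))
    have h2 : Tendsto (fun J : ℕ => s * (J:ℝ)) atTop atTop := tendsto_natCast_atTop_atTop.const_mul_atTop hs0
    simpa using (this.comp h2).const_mul (s^k)
  have hl2 := (hsum.comp hJ).sub (tendsto_finsetSum (Finset.range (K+2)) fun k _ => ((hlim k).sub_const ((s^k * h k 0 : ℝ):ℂ)).const_mul (beta M c k))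
  have := le_of_tendsto hl2.norm (Eventually.of_forall hpart)
  refine le_trans (le_of_eq ?_) this
  congr 1
  rw [sub_eq_add_neg, ← Finset.sum_neg_distrib]
  congr 1
  refine Finset.sum_congr rfl fun k _ => ?_
  rw [hs]
  push_cast
  ring

/-- the polynomials with `h_k = P_k exp(-x^2)` -/
noncomputable def P (u : ℕ) : ℕ → ℝ[X]
  | 0 => X^u
  | k+1 => derivative (P u k) - 2 * X * P u k

noncomputable def hh (u k : ℕ) (x : ℝ) : ℝ := (P u k).eval x * Real.exp (-x^2)

lemma hh_deriv (u k : ℕ) (y : ℝ) : HasDerivAt (hh u k) (hh u (k+1) y) y := by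
  have h1 : HasDerivAt (fun x : ℝ => Real.exp (-x^2)) (Real.exp (-y^2) * (-(2 * y))) y := by
    simpa using ((hasDerivAt_pow 2 y).neg).exp
  have := ((P u k).hasDerivAt y).mul h1
  exact this.congr_deriv (by simp [hh, P]; ring)

lemma poly_bound (p : ℝ[X]) : ∃ A : ℝ, ∀ x : ℝ, |p.eval x * Real.exp (-x^2)| ≤ A / (1 + x^2) := by
  have key : ∀ p : ℝ[X], ∃ A : ℝ, ∀ x : ℝ, |p.eval x * Real.exp (-x^2)| ≤ A := by
    intro p
    induction p using Polynomial.induction_on' with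
    | add p q hp hq =>
      obtain ⟨a, ha⟩ := hp
      obtain ⟨b, hb⟩ := hq
      refine ⟨a + b, fun x => ?_⟩
      rw [Polynomial.eval_add, add_mul]
      exact (abs_add_le _ _).trans (add_le_add (ha x) (hb x))
    | monomial n a =>
      refine ⟨|a| * (1 + n.factorial), fun x => ?_⟩
      rw [Polynomial.eval_monomial, abs_mul, abs_mul, mul_assoc, abs_pow, Real.abs_exp]
      refine mul_le_mul_of_nonneg_left ?_ (abs_nonneg _)
      rw [Real.exp_neg, ← div_eq_mul_inv, div_le_iff₀ (Real.exp_pos _)]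
      have h1 : (x^2)^n / n.factorial ≤ Real.exp (x^2) := Real.pow_div_factorial_le_exp _ (sq_nonneg x) n
      rw [div_le_iff₀ (by positivity)] at h1
      have h2 : 1 ≤ Real.exp (x^2) := Real.one_le_exp (sq_nonneg x)
      have h3 : (x^2)^n = (|x|^n)^2 := by rw [← sq_abs]; ring
      nlinarith [sq_nonneg (|x|^n - 1), sq_nonneg (|x|^n)]
  obtain ⟨A, hA⟩ := key ((1 + X^2) * p)
  refine ⟨A, fun x => ?_⟩
  rw [le_div_iff₀ (by positivity)]
  have := hA x
  simp only [Polynomial.eval_mul, Polynomial.eval_add, Polynomial.eval_one, Polynomial.eval_pow, Polynomial.eval_X] at this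
  rw [mul_assoc, abs_mul, abs_of_nonneg (by positivity : (0:ℝ) ≤ 1 + x^2)] at this
  linarith

/-- formal `exp(-X^2)` -/
noncomputable def Eser : PowerSeries ℝ := PowerSeries.mk fun n => if Even n then (-1)^(n/2) / ((n/2).factorial : ℝ) else 0

lemma Eser_deriv : PowerSeries.derivative ℝ Eser = - (2 * PowerSeries.X * Eser) := by
  ext n
  rw [PowerSeries.coeff_derivative]
  have : (2 * PowerSeries.X * Eser : PowerSeries ℝ) = PowerSeries.X * (Eser + Eser) := by ring
  rw [this, map_neg]
  cases n with
  | zero => simp [Eser]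
  | succ n =>
    rw [PowerSeries.coeff_succ_X_mul, map_add]
    simp only [Eser, PowerSeries.coeff_mk]
    by_cases hn : Even n
    · obtain ⟨m, rfl⟩ := hn
      rw [if_pos (by exact ⟨m+1, by ring⟩), if_pos ⟨m, rfl⟩]
      rw [show (m + m + 1 + 1)/2 = m+1 by omega, show (m+m)/2 = m by omega, Nat.factorial_succ]
      push_cast
      field_simp
      ring
    · rw [if_neg hn, if_neg (by rw [Nat.even_add_one, Nat.even_add_one]; simpa using hn)]
      simp

lemma P_ser (u k : ℕ) : ((P u k : ℝ[X]) : PowerSeries ℝ) * Eser = (PowerSeries.derivative ℝ)^[k] (PowerSeries.X^u * Eser) := by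
  induction k with
  | zero => simp [P]
  | succ k ih =>
    rw [Function.iterate_succ_apply', ← ih, Derivation.leibniz, Eser_deriv, PowerSeries.derivative_coe]
    have h2 : ((2 : ℝ[X]) : PowerSeries ℝ) = 2 := map_ofNat (Polynomial.coeToPowerSeries.ringHom) 2
    simp [P, sub_mul, h2]
    ring

lemma coeff_iter (f : PowerSeries ℝ) (k n : ℕ) : PowerSeries.coeff n ((PowerSeries.derivative ℝ)^[k] f) = (n+k).descFactorial k * PowerSeries.coeff (n+k) f := by
  induction k generalizing n with
  | zero => simp
  | succ k ih =>
    rw [Function.iterate_succ_apply', PowerSeries.coeff_derivative, ih]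
    rw [show n + (k+1) = n + 1 + k by ring, Nat.descFactorial_succ, show n + 1 + k - k = n + 1 by omega]
    push_cast
    ring

lemma hh_zero (u k : ℕ) : hh u k 0 = k.factorial * PowerSeries.coeff k (PowerSeries.X^u * Eser) := by
  have h1 := congrArg (PowerSeries.coeff 0) (P_ser u k)
  rw [coeff_iter] at h1
  simp [Nat.descFactorial_self] at h1
  have : PowerSeries.constantCoeff Eser = 1 := by
    rw [← PowerSeries.coeff_zero_eq_constantCoeff_apply]; simp [Eser]
  rw [this] at h1
  rw [← h1, hh, ← Polynomial.coeff_zero_eq_eval_zero]; simp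

lemma hh_lt (u k : ℕ) (h : k < u) : hh u k 0 = 0 := by
  rw [hh_zero, PowerSeries.coeff_X_pow_mul', if_neg (by omega), mul_zero]

lemma hh_add (u n : ℕ) : hh u (n+u) 0 = (n+u).factorial * if Even n then (-1)^(n/2) / ((n/2).factorial : ℝ) else 0 := by
  rw [hh_zero, PowerSeries.coeff_X_pow_mul, Eser, PowerSeries.coeff_mk]

lemma sum_even (u n : ℕ) (F : ℕ → ℂ) :
    ∑ k ∈ Finset.range (2*n+u), F k * hh u k 0 = ∑ r ∈ Finset.range n, F (2*r+u) * ((2*r+u).factorial * ((-1)^r / (r.factorial : ℂ))) := by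
  induction n with
  | zero =>
    simp only [mul_zero, zero_add, Finset.range_zero, Finset.sum_empty]
    refine Finset.sum_eq_zero fun k hk => ?_
    rw [hh_lt u k (Finset.mem_range.1 hk)]; simp
  | succ n ih =>
    rw [show 2*(n+1)+u = 2*n+u+1+1 by ring, Finset.sum_range_succ, Finset.sum_range_succ, ih, Finset.sum_range_succ]
    rw [show 2*n+u+1 = 2*n+1+u by ring, hh_add, hh_add, if_pos (by simp), if_neg (by simp)]
    simp

lemma Lambda_eq (M : ℕ) (C : ℤ → ℂ) (k : ℕ) :
    LambdaVal M C k = - (beta M (fun i => C ((i:ℤ)+1)) k * (M:ℂ)^k * k.factorial) := by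
  unfold LambdaVal beta
  rw [sum_Icc (fun m => C m * Polynomial.aeval ((m : ℂ) / (M : ℂ)) (Polynomial.bernoulli (k + 1)))]
  rw [neg_mul, Finset.mul_sum, Finset.sum_mul, Finset.sum_mul]
  congr 1
  refine Finset.sum_congr rfl fun i _ => ?_
  have e : Polynomial.aeval ((((i:ℤ)+1 : ℤ) : ℂ) / (M : ℂ)) (Polynomial.bernoulli (k + 1)) = ((bR (k+1) (((i:ℝ)+1)/M) : ℝ) : ℂ) := by
    have := Polynomial.aeval_algebraMap_apply ℂ (((i:ℝ)+1)/M) (Polynomial.bernoulli (k + 1))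
    simp only [Complex.coe_algebraMap] at this
    rw [bR, ← this]
    push_cast
    rfl
  rw [e, Nat.factorial_succ]
  have : (k.factorial : ℂ) ≠ 0 := by exact_mod_cast k.factorial_ne_zero
  have h2 : (k:ℂ) + 1 ≠ 0 := by exact_mod_cast k.succ_ne_zero
  push_cast
  field_simp

lemma term_eq (t : ℝ) (ht : 0 < t) (u m : ℕ) :
    Complex.exp (-(t : ℂ) * ((m : ℂ) + 1) ^ 2) * ((m:ℂ)+1)^u = ((Real.sqrt t : ℂ)^u)⁻¹ * (hh u 0 (Real.sqrt t * ((m:ℝ)+1)) : ℂ) := by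
  have hs : Real.sqrt t ≠ 0 := (Real.sqrt_pos.2 ht).ne'
  have hs' : (Real.sqrt t : ℂ)^u ≠ 0 := pow_ne_zero _ (by exact_mod_cast hs)
  simp only [hh, P, Polynomial.eval_pow, Polynomial.eval_X]
  rw [mul_pow, mul_pow, Real.sq_sqrt ht.le]
  push_cast
  rw [mul_assoc, inv_mul_cancel_left₀ hs', mul_comm, neg_mul]

lemma single (M : ℕ) (hM : 0 < M) (C : ℤ → ℂ)
    (hper : ∀ m : ℤ, C (m + M) = C m)
    (hmean : ∑ m ∈ Finset.Icc (1 : ℤ) (M : ℤ), C m = 0) (u N : ℕ) :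
    (∀ᶠ t : ℝ in nhdsWithin 0 (Set.Ioi (0:ℝ)), Summable (fun m : ℕ => C ((m : ℤ) + 1) * (Complex.exp (-(t : ℂ) * ((m : ℂ) + 1) ^ 2) * ((m:ℂ)+1)^u))) ∧
    (fun t : ℝ => (∑' m : ℕ, C ((m : ℤ) + 1) * (Complex.exp (-(t : ℂ) * ((m : ℂ) + 1) ^ 2) * ((m:ℂ)+1)^u)) -
      ∑ r ∈ Finset.range (N + 1), LambdaVal M C (2 * r + u) * (-(t : ℂ)) ^ r / (r.factorial : ℂ))
        =O[nhdsWithin 0 (Set.Ioi (0 : ℝ))] fun t : ℝ => t ^ (N + 1) := by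
  set c : ℕ → ℂ := fun i => C ((i:ℤ)+1) with hc
  have hcper : ∀ i, c (i + M) = c i := by
    intro i
    simp only [hc]
    rw [← hper ((i:ℤ)+1)]
    congr 1
    push_cast
    ring
  have hc0 : ∑ i ∈ Finset.range M, c i = 0 := by rw [← hmean, sum_Icc]
  choose A hA using fun k => poly_bound (P u k)
  obtain ⟨E, hE⟩ := main_EM M hM c hcper hc0 (hh u) (hh_deriv u) A hA (2*N+2+u)
  have hM1 : (1:ℝ) ≤ M := by exact_mod_cast hM
  have hsmall : ∀ᶠ t : ℝ in nhdsWithin 0 (Set.Ioi (0:ℝ)), 0 < t ∧ M * Real.sqrt t ≤ 1 := by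
    refine (eventually_mem_nhdsWithin).and ?_
    have : Tendsto (fun t => M * Real.sqrt t) (nhdsWithin 0 (Set.Ioi (0:ℝ))) (nhds (M * Real.sqrt 0)) :=
      ((continuous_const.mul Real.continuous_sqrt).tendsto 0).mono_left nhdsWithin_le_nhds
    rw [Real.sqrt_zero, mul_zero] at this
    exact this.eventually_le_const one_pos
  constructor
  · filter_upwards [hsmall] with t ht
    have hs := Real.sqrt_pos.2 ht.1
    simp only [term_eq t ht.1]
    refine ((summable_main M hM c hcper (hh u 0) (A 0) (hA 0) (Real.sqrt t) hs (by nlinarith [ht.2])).mul_left ((Real.sqrt t : ℂ)^u)⁻¹).congr fun m => ?_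
    simp only [hc]; ring
  have main : (fun t : ℝ => (∑' m : ℕ, C ((m : ℤ) + 1) * (Complex.exp (-(t : ℂ) * ((m : ℂ) + 1) ^ 2) * ((m:ℂ)+1)^u)) -
      ∑ r ∈ Finset.range (N + 2), LambdaVal M C (2 * r + u) * (-(t : ℂ)) ^ r / (r.factorial : ℂ))
        =O[nhdsWithin 0 (Set.Ioi (0 : ℝ))] fun t : ℝ => t ^ (N + 1) := by
    refine IsBigO.of_bound E ?_
    filter_upwards [hsmall] with t ht
    have hs := Real.sqrt_pos.2 ht.1
    have hs' : (Real.sqrt t : ℂ)^u ≠ 0 := pow_ne_zero _ (by exact_mod_cast hs.ne')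
    have h1 := hE (Real.sqrt t) hs ht.2
    have hsq : (Real.sqrt t : ℂ)^2 = t := by exact_mod_cast Real.sq_sqrt ht.1.le
    rw [show 2*N+2+u+2 = 2*(N+2)+u by ring, sum_even u (N+2) (fun k => beta M c k * (M * (Real.sqrt t : ℂ))^k)] at h1
    have e : (∑' m : ℕ, C ((m : ℤ) + 1) * (Complex.exp (-(t : ℂ) * ((m : ℂ) + 1) ^ 2) * ((m:ℂ)+1)^u)) -
      ∑ r ∈ Finset.range (N + 2), LambdaVal M C (2 * r + u) * (-(t : ℂ)) ^ r / (r.factorial : ℂ) = ((Real.sqrt t : ℂ)^u)⁻¹ * (∑' n : ℕ, c n * (hh u 0 (Real.sqrt t * ((n:ℝ)+1)) : ℂ) + ∑ r ∈ Finset.range (N+2), beta M c (2*r+u) * (M * (Real.sqrt t : ℂ))^(2*r+u) * ((2*r+u).factorial * ((-1)^r / (r.factorial : ℂ)))) := by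
      rw [mul_add, ← tsum_mul_left, sub_eq_add_neg]
      congr 1
      · refine tsum_congr fun m => ?_
        rw [term_eq t ht.1]; simp only [hc]; ring
      · rw [← Finset.sum_neg_distrib, Finset.mul_sum]
        refine Finset.sum_congr rfl fun r _ => ?_
        rw [Lambda_eq, mul_pow, pow_add (Real.sqrt t : ℂ), pow_mul (Real.sqrt t : ℂ), hsq, neg_pow]
        field_simp
        ring
    rw [e, norm_mul, norm_inv, norm_pow, Complex.norm_real, Real.norm_of_nonneg hs.le, Real.norm_of_nonneg (by have := ht.1; positivity)]
    rw [inv_mul_le_iff₀ (by positivity)]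
    refine h1.trans (le_of_eq ?_)
    rw [pow_add, show 2*N+2 = 2*(N+1) by ring, pow_mul, Real.sq_sqrt ht.1.le]
    ring
  have extra : (fun t : ℝ => LambdaVal M C (2 * (N+1) + u) * (-(t : ℂ)) ^ (N+1) / ((N+1).factorial : ℂ))
        =O[nhdsWithin 0 (Set.Ioi (0 : ℝ))] fun t : ℝ => t ^ (N + 1) := by
    refine IsBigO.of_bound (‖LambdaVal M C (2 * (N+1) + u)‖ / ((N+1).factorial : ℝ)) (Eventually.of_forall fun t => le_of_eq ?_)
    simp
    ring
  refine (main.add extra).congr_left fun t => ?_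
  rw [Finset.sum_range_succ _ (N+1)]
  ring

end S8

theorem statement8 (M : ℕ) (hM : 0 < M) (C : ℤ → ℂ)
    (hper : ∀ m : ℤ, C (m + M) = C m)
    (hmean : ∑ m ∈ Finset.Icc (1 : ℤ) (M : ℤ), C m = 0)
    (d : ℕ) (a : ℕ → ℂ) :
    ∀ N : ℕ,
      (fun t : ℝ =>
          (∑' m : ℕ, Complex.exp (-(t : ℂ) * ((m : ℂ) + 1) ^ 2) * C ((m : ℤ) + 1) *
              (∑ u ∈ Finset.range (d + 1), a u * ((m : ℂ) + 1) ^ u)) -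
            ∑ u ∈ Finset.range (d + 1), ∑ r ∈ Finset.range (N + 1),
              a u * LambdaVal M C (2 * r + u) * (-(t : ℂ)) ^ r / (r.factorial : ℂ))
        =O[nhdsWithin 0 (Set.Ioi (0 : ℝ))] fun t : ℝ => t ^ (N + 1) := by
  intro N
  have hs := fun u => S8.single M hM C hper hmean u N
  have hall : ∀ᶠ t : ℝ in nhdsWithin 0 (Set.Ioi (0:ℝ)), ∀ u ∈ Finset.range (d+1), Summable (fun m : ℕ => C ((m : ℤ) + 1) * (Complex.exp (-(t : ℂ) * ((m : ℂ) + 1) ^ 2) * ((m:ℂ)+1)^u)) :=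
    (Finset.eventually_all _).2 fun u _ => (hs u).1
  have hO := IsBigO.sum (s := Finset.range (d+1)) fun u _ => ((hs u).2.const_mul_left (a u))
  refine hO.congr' ?_ EventuallyEq.rfl
  filter_upwards [hall] with t ht
  simp only [Finset.sum_apply, mul_sub, Finset.sum_sub_distrib]
  congr 1
  · simp only [← tsum_mul_left]
    rw [← Summable.tsum_finsetSum fun u hu => (ht u hu).mul_left (a u)]
    refine tsum_congr fun m => ?_
    rw [Finset.mul_sum]
    exact Finset.sum_congr rfl fun u _ => by ring
  · refine Finset.sum_congr rfl fun u _ => ?_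
    rw [Finset.mul_sum]
    exact Finset.sum_congr rfl fun r _ => by ring
end
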